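/- arXiv:1606.08937 — 2 statements merged into one kernel-verified Lean document; each statement's English description precedes it below -/
import Mathlib

section
/- Let p > 0 and 0 < r < 1. Then S_{2,p}(r) = (1/(2r)²) S_{1,p}(r) − (p^{3/2}/(2r)²) ∑_{n≥1} ( K_3(2√(p(n + ir))) / (n + ir)^{3/2} + K_3(2√(p(n − ir))) / (n − ir)^{3/2} ), where complex powers and square roots are principal and the sum over n is a real number (the two summands are complex conjugates). -/
open Real MeasureTheory

/-- Bessel function of the first kind of integer order, via Bessel's integral. -/
noncomputable def besselJ (m : ℤ) (x : ℝ) : ℝ :=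
  (1 / Real.pi) * ∫ θ in (0:ℝ)..Real.pi, Real.cos ((m : ℝ) * θ - x * Real.sin θ)

/-- Modified Bessel function of the second kind (real argument). -/
noncomputable def besselK (ν x : ℝ) : ℝ :=
  ∫ t in Set.Ioi (0:ℝ), Real.exp (-x * Real.cosh t) * Real.cosh (ν * t)

/-- Modified Bessel function of the second kind (complex argument). -/
noncomputable def besselKC (ν : ℝ) (z : ℂ) : ℂ :=
  ∫ t in Set.Ioi (0:ℝ), Complex.exp (-z * (Real.cosh t : ℂ)) * (Real.cosh (ν * t) : ℂ)

/-- The p-extended Riemann zeta function. -/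
noncomputable def zetaP (p α : ℝ) : ℝ :=
  (1 / Real.Gamma α) *
    ∫ t in Set.Ioi (0:ℝ), t ^ (α - 1) * Real.exp (-p / t) / (Real.exp t - 1)

/-- The p-extended Mathieu series. -/
noncomputable def mathieuS (μ p r : ℝ) : ℝ :=
  2 * ∑' n : ℕ, (-1 : ℝ) ^ n *
      (Real.Gamma (μ + n + 1) / (n.factorial * Real.Gamma (μ + 1))) *
      zetaP p (2 * μ + 2 * n + 1) * r ^ (2 * n)

/-- Parameter integrals `∫ e^{-zφ} w` with `φ ≥ 0` are holomorphic in the right half-plane. -/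
theorem differentiableOn_integral_cexp_neg_mul {α : Type*} [MeasurableSpace α] {μ : Measure α}
    {φ w : α → ℝ} (hφ : Measurable φ) (hw : Measurable w) (hφ0 : ∀ᵐ t ∂μ, 0 ≤ φ t)
    (hint : ∀ x : ℝ, 0 < x → Integrable (fun t => Real.exp (-x * φ t) * w t) μ) :
    DifferentiableOn ℂ (fun z : ℂ => ∫ t, Complex.exp (-z * (φ t : ℂ)) * (w t : ℂ) ∂μ)
      {z : ℂ | 0 < z.re} := by
  intro z₀ hz₀
  have hz₀ : 0 < z₀.re := hz₀
  set c := z₀.re / 4 with hc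
  have hc0 : 0 < c := by positivity
  have hmeas : ∀ z : ℂ, Measurable fun t => Complex.exp (-z * (φ t : ℂ)) * (w t : ℂ) := by
    intro z; fun_prop
  have hnorm : ∀ (z : ℂ) (t : α), ‖Complex.exp (-z * (φ t : ℂ)) * (w t : ℂ)‖ =
      Real.exp (-z.re * φ t) * |w t| := by
    intro z t
    rw [norm_mul, Complex.norm_exp, Complex.norm_real, Real.norm_eq_abs]
    simp
  have key := hasDerivAt_integral_of_dominated_loc_of_deriv_le (μ := μ) (𝕜 := ℂ)
    (F := fun z t => Complex.exp (-z * (φ t : ℂ)) * (w t : ℂ))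
    (F' := fun z t => -(φ t : ℂ) * (Complex.exp (-z * (φ t : ℂ)) * (w t : ℂ)))
    (x₀ := z₀) (s := {z : ℂ | 2 * c < z.re})
    (bound := fun t => c⁻¹ * |Real.exp (-c * φ t) * w t|)
    ((isOpen_lt continuous_const Complex.continuous_re).mem_nhds
      (show 2 * c < z₀.re by rw [hc]; linarith))
    (Filter.Eventually.of_forall fun z => (hmeas z).aestronglyMeasurable)
    ?_ ?_ ?_ ((hint c hc0).abs.const_mul _) ?_
  · exact key.2.differentiableAt.differentiableWithinAt
  · refine (hint _ hz₀).mono (hmeas _).aestronglyMeasurable (Filter.Eventually.of_forall fun t => ?_)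
    rw [hnorm, norm_mul, Real.norm_eq_abs, Real.norm_eq_abs, Real.abs_exp]
  · exact Measurable.aestronglyMeasurable (by fun_prop)
  · filter_upwards [hφ0] with t ht z hz
    have hz : 2 * c < z.re := hz
    rw [norm_mul, hnorm, norm_neg, Complex.norm_real, Real.norm_eq_abs, abs_of_nonneg ht, abs_mul,
      Real.abs_exp, ← mul_assoc, ← mul_assoc]
    refine mul_le_mul_of_nonneg_right ?_ (abs_nonneg _)
    have h1 : φ t ≤ c⁻¹ * Real.exp (c * φ t) := by
      rw [inv_mul_eq_div, le_div_iff₀ hc0]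
      linarith [Real.add_one_le_exp (c * φ t)]
    calc φ t * Real.exp (-z.re * φ t)
        ≤ c⁻¹ * Real.exp (c * φ t) * Real.exp (-(2 * c) * φ t) := by
          gcongr
      _ = c⁻¹ * Real.exp (-c * φ t) := by
          rw [mul_assoc, ← Real.exp_add]; ring_nf
  · refine Filter.Eventually.of_forall fun t z _ => ?_
    have := (((hasDerivAt_id z).neg.mul_const (φ t : ℂ)).cexp).mul_const (w t : ℂ)
    refine this.congr_deriv ?_
    simp only [id_eq, Pi.neg_apply]
    ring

theorem Real.exp_image_const_mul {c : ℝ} (hc : 0 < c) :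
    (fun s : ℝ => c * Real.exp s) '' Set.univ = Set.Ioi 0 := by
  ext t
  simp only [Set.image_univ, Set.mem_range, Set.mem_Ioi]
  constructor
  · rintro ⟨s, rfl⟩; positivity
  · intro ht
    exact ⟨Real.log (t / c), by rw [Real.exp_log (by positivity)]; field_simp⟩

theorem injOn_const_mul_exp {c : ℝ} (hc : 0 < c) :
    Set.InjOn (fun s : ℝ => c * Real.exp s) Set.univ := by
  intro a _ b _ h
  exact Real.exp_injective (mul_left_cancel₀ hc.ne' h)

theorem sq_mul_exp_comp_const_mul_exp {x p s : ℝ} (hx : 0 < x) (hp : 0 < p) :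
    |√(p / x) * Real.exp s| • ((√(p / x) * Real.exp s) ^ 2 *
        Real.exp (-x * (√(p / x) * Real.exp s) - p / (√(p / x) * Real.exp s))) =
      √(p / x) ^ 3 * (Real.exp (3 * s) * Real.exp (-(2 * √(p * x)) * Real.cosh s)) := by
  have hp' := Real.sqrt_pos.2 hp
  have hx' := Real.sqrt_pos.2 hx
  rw [abs_of_nonneg (by positivity), smul_eq_mul, Real.cosh_eq, Real.exp_neg,
    show (3 : ℝ) * s = s + s + s by ring, Real.exp_add, Real.exp_add, Real.sqrt_div hp.le,
    Real.sqrt_mul hp.le]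
  have h : -x * (√p / √x * Real.exp s) - p / (√p / √x * Real.exp s) =
      -(2 * (√p * √x)) * ((Real.exp s + (Real.exp s)⁻¹) / 2) := by
    have := Real.exp_pos s
    have hx2 := Real.mul_self_sqrt hx.le
    have hp2 := Real.mul_self_sqrt hp.le
    generalize √x = u at *
    generalize √p = v at *
    subst hx2 hp2
    field_simp
    ring
  rw [h]
  ring

theorem integrableOn_sq_mul_exp {x p : ℝ} (hx : 0 < x) (hp : 0 < p) :
    IntegrableOn (fun t : ℝ => t ^ 2 * Real.exp (-x * t - p / t)) (Set.Ioi 0) := by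
  refine (integrableOn_rpow_mul_exp_neg_mul_rpow (s := 2) (p := 1) (b := x) (by norm_num)
    one_pos hx).mono' (Measurable.aestronglyMeasurable (by fun_prop)) ?_
  refine (ae_restrict_iff' measurableSet_Ioi).2 (Filter.Eventually.of_forall fun t ht => ?_)
  have ht : 0 < t := ht
  have : 0 < p / t := by positivity
  rw [Real.norm_of_nonneg (by positivity), Real.rpow_one, Real.rpow_two]
  gcongr
  linarith

theorem integral_sq_mul_exp_eq_integral_exp_cosh {x p : ℝ} (hx : 0 < x) (hp : 0 < p) :
    ∫ t in Set.Ioi (0 : ℝ), t ^ 2 * Real.exp (-x * t - p / t) = √(p / x) ^ 3 *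
      ∫ s : ℝ, Real.exp (3 * s) * Real.exp (-(2 * √(p * x)) * Real.cosh s) := by
  have hc : 0 < √(p / x) := Real.sqrt_pos.2 (by positivity)
  have h := integral_image_eq_integral_abs_deriv_smul (s := Set.univ)
    (f := fun s : ℝ => √(p / x) * Real.exp s) (f' := fun s : ℝ => √(p / x) * Real.exp s)
    MeasurableSet.univ (fun s _ => ((Real.hasDerivAt_exp s).const_mul _).hasDerivWithinAt)
    (injOn_const_mul_exp hc) (fun t : ℝ => t ^ 2 * Real.exp (-x * t - p / t))
  rw [Real.exp_image_const_mul hc] at h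
  rw [h, setIntegral_univ, ← integral_const_mul]
  exact integral_congr_ae (Filter.Eventually.of_forall fun s =>
    sq_mul_exp_comp_const_mul_exp hx hp)

theorem integrable_exp_mul_exp_neg_cosh {y : ℝ} (hy : 0 < y) :
    Integrable fun s : ℝ => Real.exp (3 * s) * Real.exp (-y * Real.cosh s) := by
  have hx : 0 < y / 2 := by positivity
  have hc : 0 < √((y / 2) / (y / 2)) := Real.sqrt_pos.2 (by positivity)
  have h := (integrableOn_image_iff_integrableOn_abs_deriv_smul (s := Set.univ)
    (f := fun s : ℝ => √((y / 2) / (y / 2)) * Real.exp s)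
    (f' := fun s : ℝ => √((y / 2) / (y / 2)) * Real.exp s)
    MeasurableSet.univ (fun s _ => ((Real.hasDerivAt_exp s).const_mul _).hasDerivWithinAt)
    (injOn_const_mul_exp hc) (fun t : ℝ => t ^ 2 * Real.exp (-(y / 2) * t - (y / 2) / t))).1
  rw [Real.exp_image_const_mul hc, integrableOn_univ] at h
  refine (h (integrableOn_sq_mul_exp hx hx)).congr (Filter.Eventually.of_forall fun s => ?_)
  refine (sq_mul_exp_comp_const_mul_exp hx hx).trans ?_
  rw [div_self hx.ne', Real.sqrt_mul_self hx.le, Real.sqrt_one, one_pow, one_mul,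
    mul_div_cancel₀ y two_ne_zero]

theorem exp_neg_cosh_mul_cosh_eq (y s : ℝ) :
    Real.exp (-y * Real.cosh s) * Real.cosh (3 * s) =
      2⁻¹ * (Real.exp (3 * s) * Real.exp (-y * Real.cosh s) +
        Real.exp (3 * -s) * Real.exp (-y * Real.cosh (-s))) := by
  rw [Real.cosh_neg, Real.cosh_eq (3 * s)]
  ring_nf

theorem integrable_exp_neg_cosh_mul_cosh {y : ℝ} (hy : 0 < y) :
    Integrable fun s : ℝ => Real.exp (-y * Real.cosh s) * Real.cosh (3 * s) := by
  have h := integrable_exp_mul_exp_neg_cosh hy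
  exact ((h.add h.comp_neg).const_mul 2⁻¹).congr
    (Filter.Eventually.of_forall fun s => (exp_neg_cosh_mul_cosh_eq y s).symm)

theorem integral_exp_mul_exp_neg_cosh {y : ℝ} (hy : 0 < y) :
    ∫ s : ℝ, Real.exp (3 * s) * Real.exp (-y * Real.cosh s) =
      2 * ∫ s in Set.Ioi (0 : ℝ), Real.exp (-y * Real.cosh s) * Real.cosh (3 * s) := by
  have h := integrable_exp_mul_exp_neg_cosh hy
  rw [← integral_comp_abs (f := fun s => Real.exp (-y * Real.cosh s) * Real.cosh (3 * s))]
  have habs : ∀ s : ℝ, Real.exp (-y * Real.cosh |s|) * Real.cosh (3 * |s|) =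
      Real.exp (-y * Real.cosh s) * Real.cosh (3 * s) := by
    intro s
    rw [Real.cosh_abs, ← Real.cosh_abs (3 * s), abs_mul]
    norm_num
  simp only [habs, exp_neg_cosh_mul_cosh_eq]
  rw [integral_const_mul, integral_add h h.comp_neg,
    integral_neg_eq_self (fun s : ℝ => Real.exp (3 * s) * Real.exp (-y * Real.cosh s)) volume]
  ring

theorem Complex.re_cpow_half_pos {z : ℂ} (hz : 0 < z.re) : 0 < (z ^ (1 / 2 : ℂ)).re := by
  have hz0 : z ≠ 0 := fun h => by simp [h] at hz
  have him : (Complex.log z * (1 / 2 : ℂ)).im = Complex.arg z / 2 := by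
    rw [show (1 / 2 : ℂ) = ((1 / 2 : ℝ) : ℂ) by norm_num, Complex.im_mul_ofReal, Complex.log_im]
    ring
  rw [Complex.cpow_def_of_ne_zero hz0, Complex.exp_re, him]
  have h1 := abs_le.1 (Complex.abs_arg_le_pi z)
  have h2 := abs_lt.1 (Complex.abs_arg_lt_pi_div_two_iff.2 (Or.inl hz))
  exact mul_pos (Real.exp_pos _) (Real.cos_pos_of_mem_Ioo ⟨by linarith, by linarith⟩)

theorem differentiableOn_besselKC_three :
    DifferentiableOn ℂ (besselKC 3) {z : ℂ | 0 < z.re} :=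
  differentiableOn_integral_cexp_neg_mul Real.measurable_cosh
    (Real.measurable_cosh.comp (measurable_const_mul 3))
    (Filter.Eventually.of_forall fun t => (Real.cosh_pos t).le)
    fun _ hx => (integrable_exp_neg_cosh_mul_cosh hx).integrableOn

theorem integral_cexp_neg_mul_sq_ofReal {x p : ℝ} (hx : 0 < x) (hp : 0 < p) :
    ∫ t in Set.Ioi (0 : ℝ), Complex.exp (-(x : ℂ) * (t : ℂ)) *
        ((t ^ 2 * Real.exp (-p / t) : ℝ) : ℂ) =
      2 * (p : ℂ) ^ (3 / 2 : ℂ) *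
        (besselKC 3 (2 * ((p : ℂ) * x) ^ (1 / 2 : ℂ)) / (x : ℂ) ^ (3 / 2 : ℂ)) := by
  have hpx : 0 < p * x := by positivity
  have hpow : ∀ a : ℝ, 0 ≤ a → (a : ℂ) ^ (3 / 2 : ℂ) = ((√a ^ 3 : ℝ) : ℂ) := by
    intro a ha
    rw [show (3 / 2 : ℂ) = ((3 / 2 : ℝ) : ℂ) by norm_num, ← Complex.ofReal_cpow ha,
      Real.sqrt_eq_rpow, ← Real.rpow_natCast, ← Real.rpow_mul ha]
    norm_num
  have hhalf : (2 : ℂ) * ((p : ℂ) * x) ^ (1 / 2 : ℂ) = ((2 * √(p * x) : ℝ) : ℂ) := by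
    rw [show (1 / 2 : ℂ) = ((1 / 2 : ℝ) : ℂ) by norm_num, ← Complex.ofReal_mul,
      ← Complex.ofReal_cpow hpx.le, Real.sqrt_eq_rpow]
    norm_num
  have hK : besselKC 3 ((2 * √(p * x) : ℝ) : ℂ) =
      ((∫ s in Set.Ioi (0 : ℝ), Real.exp (-(2 * √(p * x)) * Real.cosh s) * Real.cosh (3 * s) : ℝ) :
        ℂ) := by
    rw [besselKC, ← integral_complex_ofReal]
    refine integral_congr_ae (Filter.Eventually.of_forall fun s => ?_)
    push_cast
    rfl
  have hL : ∫ t in Set.Ioi (0 : ℝ), Complex.exp (-(x : ℂ) * (t : ℂ)) *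
        ((t ^ 2 * Real.exp (-p / t) : ℝ) : ℂ) =
      ((∫ t in Set.Ioi (0 : ℝ), t ^ 2 * Real.exp (-x * t - p / t) : ℝ) : ℂ) := by
    rw [← integral_complex_ofReal]
    refine integral_congr_ae (Filter.Eventually.of_forall fun t => ?_)
    dsimp only
    rw [sub_eq_add_neg, Real.exp_add, ← neg_div]
    push_cast
    ring
  rw [hL, hhalf, hK, hpow p hp.le, hpow x hx.le, integral_sq_mul_exp_eq_integral_exp_cosh hx hp,
    integral_exp_mul_exp_neg_cosh (by positivity), Real.sqrt_div hp.le, ← Complex.ofReal_div]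
  push_cast
  ring

theorem integral_cexp_neg_mul_sq {p : ℝ} (hp : 0 < p) {a : ℂ} (ha : 0 < a.re) :
    ∫ t in Set.Ioi (0 : ℝ), Complex.exp (-a * (t : ℂ)) *
        ((t ^ 2 * Real.exp (-p / t) : ℝ) : ℂ) =
      2 * (p : ℂ) ^ (3 / 2 : ℂ) *
        (besselKC 3 (2 * ((p : ℂ) * a) ^ (1 / 2 : ℂ)) / a ^ (3 / 2 : ℂ)) := by
  have hopen : IsOpen {z : ℂ | 0 < z.re} := isOpen_lt continuous_const Complex.continuous_re
  have hpre : ∀ z : ℂ, 0 < z.re → 0 < ((p : ℂ) * z).re := fun z hz => by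
    rw [Complex.re_ofReal_mul]; positivity
  have hL : DifferentiableOn ℂ (fun z : ℂ => ∫ t in Set.Ioi (0 : ℝ), Complex.exp (-z * (t : ℂ)) *
      ((t ^ 2 * Real.exp (-p / t) : ℝ) : ℂ)) {z : ℂ | 0 < z.re} := by
    refine differentiableOn_integral_cexp_neg_mul (φ := fun t => t) measurable_id (by fun_prop)
      ((ae_restrict_iff' measurableSet_Ioi).2
        (Filter.Eventually.of_forall fun t ht => le_of_lt ht)) fun x hx => ?_
    refine (integrableOn_sq_mul_exp hx hp).congr (Filter.Eventually.of_forall fun t => ?_)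
    dsimp only
    rw [sub_eq_add_neg, Real.exp_add, ← neg_div]
    ring
  have hR : DifferentiableOn ℂ (fun z : ℂ => 2 * (p : ℂ) ^ (3 / 2 : ℂ) *
      (besselKC 3 (2 * ((p : ℂ) * z) ^ (1 / 2 : ℂ)) / z ^ (3 / 2 : ℂ))) {z : ℂ | 0 < z.re} := by
    refine DifferentiableOn.const_mul (DifferentiableOn.div ?_ ?_ ?_) _
    · refine DifferentiableOn.fun_comp (g := besselKC 3)
        (f := fun z : ℂ => 2 * ((p : ℂ) * z) ^ (1 / 2 : ℂ)) differentiableOn_besselKC_three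
        ?_ fun z hz => ?_
      · exact ((differentiableOn_id.const_mul _).cpow_const
          fun z hz => Or.inl (hpre z hz)).const_mul _
      · have := Complex.re_cpow_half_pos (hpre z hz)
        simpa using this
    · exact differentiableOn_id.cpow_const fun z hz => Or.inl hz
    · intro z hz
      have hz : 0 < z.re := hz
      exact (Complex.cpow_ne_zero_iff_of_exponent_ne_zero (by norm_num)).2
        fun h => by simp [h] at hz
  refine (hL.analyticOnNhd hopen).eqOn_of_preconnected_of_frequently_eq (z₀ := 1)
    (hR.analyticOnNhd hopen) (convex_halfSpace_re_gt 0).isPreconnected (by simp) ?_ ha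
  have htend : Filter.Tendsto (fun x : ℝ => (x : ℂ)) (nhdsWithin 1 {1}ᶜ)
      (nhdsWithin (1 : ℂ) {1}ᶜ) := by
    refine tendsto_nhdsWithin_iff.2 ⟨?_, ?_⟩
    · exact (Complex.continuous_ofReal.tendsto' 1 1 (by simp)).mono_left nhdsWithin_le_nhds
    · filter_upwards [self_mem_nhdsWithin] with x hx
      simpa using hx
  refine htend.frequently (Filter.Eventually.frequently ?_)
  filter_upwards [mem_nhdsWithin_of_mem_nhds (Ioi_mem_nhds (zero_lt_one (α := ℝ)))] with x hx
  exact integral_cexp_neg_mul_sq_ofReal hx hp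

theorem zetaP_natCast_add_one (p : ℝ) (k : ℕ) :
    zetaP p (k + 1) = (1 / (k.factorial : ℝ)) *
      ∫ t in Set.Ioi (0 : ℝ), t ^ k * (Real.exp (-p / t) / (Real.exp t - 1)) := by
  rw [zetaP, Real.Gamma_nat_eq_factorial, add_sub_cancel_right]
  simp only [Real.rpow_natCast, mul_div_assoc]

theorem integrableOn_sq_mul_cosh_mul {p r : ℝ} (hp : 0 < p) (hr0 : 0 ≤ r) (hr1 : r < 1) :
    IntegrableOn (fun t : ℝ => Real.cosh (r * t) *
      (t ^ 2 * (Real.exp (-p / t) / (Real.exp t - 1)))) (Set.Ioi 0) := by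
  have hr : 0 < 1 - r := by linarith
  have h1 := integrableOn_rpow_mul_exp_neg_mul_rpow (s := 1) (p := 1) (b := 1 - r)
    (by norm_num) one_pos hr
  have h2 := integrableOn_rpow_mul_exp_neg_mul_rpow (s := 2) (p := 1) (b := 1 - r)
    (by norm_num) one_pos hr
  refine (h1.add h2).mono' (Measurable.aestronglyMeasurable (by fun_prop)) ?_
  refine (ae_restrict_iff' measurableSet_Ioi).2 (Filter.Eventually.of_forall fun t ht => ?_)
  have ht : 0 < t := ht
  have het : 0 < Real.exp t - 1 := by linarith [Real.add_one_lt_exp ht.ne']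
  have hcosh : Real.cosh (r * t) ≤ Real.exp (r * t) := by
    rw [Real.cosh_eq]
    have : Real.exp (-(r * t)) ≤ Real.exp (r * t) :=
      Real.exp_le_exp.2 (by nlinarith [mul_nonneg hr0 ht.le])
    linarith
  have hexp : Real.exp (-p / t) ≤ 1 :=
    Real.exp_le_one_iff.2 (div_nonpos_of_nonpos_of_nonneg (by linarith) ht.le)
  have hfrac : t / (Real.exp t - 1) ≤ (1 + t) * Real.exp (-t) := by
    rw [div_le_iff₀ het, Real.exp_neg]
    have := Real.add_one_le_exp t
    have h0 := Real.exp_pos t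
    rw [mul_assoc, inv_mul_eq_div, mul_div_assoc', le_div_iff₀ h0]
    nlinarith
  rw [Real.norm_of_nonneg (mul_nonneg (Real.cosh_pos _).le (by positivity))]
  simp only [Pi.add_apply, Real.rpow_one, Real.rpow_two]
  calc Real.cosh (r * t) * (t ^ 2 * (Real.exp (-p / t) / (Real.exp t - 1)))
      = Real.cosh (r * t) * (t * Real.exp (-p / t) * (t / (Real.exp t - 1))) := by ring
    _ ≤ Real.exp (r * t) * (t * 1 * ((1 + t) * Real.exp (-t))) := by gcongr
    _ = _ := by
      rw [show -(1 - r) * t = r * t + -t by ring, Real.exp_add]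
      ring

theorem integrableOn_sq_mul {p : ℝ} (hp : 0 < p) :
    IntegrableOn (fun t : ℝ => t ^ 2 * (Real.exp (-p / t) / (Real.exp t - 1))) (Set.Ioi 0) := by
  simpa using integrableOn_sq_mul_cosh_mul hp le_rfl one_pos

theorem hasSum_integral_pow_cos {p r : ℝ} (hp : 0 < p) (hr0 : 0 ≤ r) (hr1 : r < 1) :
    HasSum (fun m : ℕ => (-1) ^ m * r ^ (2 * m) / ((2 * m).factorial : ℝ) *
        ∫ t in Set.Ioi (0 : ℝ), t ^ (2 * m + 2) * (Real.exp (-p / t) / (Real.exp t - 1)))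
      (∫ t in Set.Ioi (0 : ℝ), Real.cos (r * t) *
        (t ^ 2 * (Real.exp (-p / t) / (Real.exp t - 1)))) := by
  have key := hasSum_integral_of_dominated_convergence (μ := volume.restrict (Set.Ioi (0 : ℝ)))
    (F := fun (m : ℕ) (t : ℝ) => (-1) ^ m * (r * t) ^ (2 * m) / ((2 * m).factorial : ℝ) *
      (t ^ 2 * (Real.exp (-p / t) / (Real.exp t - 1))))
    (f := fun t => Real.cos (r * t) * (t ^ 2 * (Real.exp (-p / t) / (Real.exp t - 1))))
    (fun (m : ℕ) (t : ℝ) => (r * t) ^ (2 * m) / ((2 * m).factorial : ℝ) *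
      |t ^ 2 * (Real.exp (-p / t) / (Real.exp t - 1))|)
    (fun m => Measurable.aestronglyMeasurable (by fun_prop))
    (fun m => Filter.Eventually.of_forall fun t => ?_)
    (Filter.Eventually.of_forall fun t => (Real.hasSum_cosh (r * t)).summable.mul_right _)
    ?_ (Filter.Eventually.of_forall fun t => (Real.hasSum_cos (r * t)).mul_right _)
  · refine (congrArg (HasSum · _) (funext fun m => ?_)).mp key
    rw [← integral_const_mul]
    refine integral_congr_ae (Filter.Eventually.of_forall fun t => ?_)
    ring
  · rw [norm_mul, Real.norm_eq_abs, Real.norm_eq_abs, abs_div, abs_mul, abs_pow, abs_neg, abs_one,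
      one_pow, one_mul, Nat.abs_cast, abs_of_nonneg ((even_two_mul m).pow_nonneg (r * t))]
  · refine (integrableOn_sq_mul_cosh_mul hp hr0 hr1).abs.congr
      (Filter.Eventually.of_forall fun t => ?_)
    dsimp only
    rw [((Real.hasSum_cosh (r * t)).mul_right _).tsum_eq, abs_mul, abs_of_pos (Real.cosh_pos _)]

theorem hasSum_integral_exp_cos {p : ℝ} (hp : 0 < p) (r : ℝ) :
    HasSum (fun n : ℕ => ∫ t in Set.Ioi (0 : ℝ), Real.exp (-(n + 1) * t) *
        (Real.cos (r * t) * (t ^ 2 * Real.exp (-p / t))))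
      (∫ t in Set.Ioi (0 : ℝ), Real.cos (r * t) *
        (t ^ 2 * (Real.exp (-p / t) / (Real.exp t - 1)))) := by
  have hgeom : ∀ t : ℝ, 0 < t →
      HasSum (fun n : ℕ => Real.exp (-(n + 1) * t)) (1 / (Real.exp t - 1)) := by
    intro t ht
    have h := (hasSum_geometric_of_lt_one (Real.exp_pos (-t)).le
      (Real.exp_lt_one_iff.2 (neg_lt_zero.2 ht))).mul_left (Real.exp (-t))
    have hterm : ∀ n : ℕ, Real.exp (-t) * Real.exp (-t) ^ n = Real.exp (-(n + 1) * t) := by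
      intro n
      rw [← Real.exp_nat_mul, ← Real.exp_add]
      ring_nf
    have hval : Real.exp (-t) * (1 - Real.exp (-t))⁻¹ = 1 / (Real.exp t - 1) := by
      have h3 := Real.exp_pos t
      rw [Real.exp_neg, ← mul_inv, mul_sub, mul_one, mul_inv_cancel₀ h3.ne', one_div]
    simpa only [hterm, hval] using h
  refine hasSum_integral_of_dominated_convergence (μ := volume.restrict (Set.Ioi (0 : ℝ)))
    (fun (n : ℕ) (t : ℝ) => Real.exp (-(n + 1) * t) * (t ^ 2 * Real.exp (-p / t)))
    (fun m => Measurable.aestronglyMeasurable (by fun_prop))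
    (fun m => Filter.Eventually.of_forall fun t => ?_) ?_ ?_ ?_
  · rw [norm_mul, norm_mul, Real.norm_of_nonneg (Real.exp_pos _).le, Real.norm_eq_abs,
      Real.norm_of_nonneg (by positivity : 0 ≤ t ^ 2 * Real.exp (-p / t))]
    have := Real.abs_cos_le_one (r * t)
    exact mul_le_mul_of_nonneg_left (mul_le_of_le_one_left (by positivity) this)
      (Real.exp_pos _).le
  · refine (ae_restrict_iff' measurableSet_Ioi).2 (Filter.Eventually.of_forall fun t ht => ?_)
    exact (hgeom t ht).summable.mul_right _
  · refine (integrableOn_sq_mul hp).congr ((ae_restrict_iff' measurableSet_Ioi).2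
      (Filter.Eventually.of_forall fun t ht => ?_))
    dsimp only
    rw [((hgeom t ht).mul_right _).tsum_eq]
    ring
  · refine (ae_restrict_iff' measurableSet_Ioi).2 (Filter.Eventually.of_forall fun t ht => ?_)
    have h := (hgeom t ht).mul_right (Real.cos (r * t) * (t ^ 2 * Real.exp (-p / t)))
    rwa [show 1 / (Real.exp t - 1) * (Real.cos (r * t) * (t ^ 2 * Real.exp (-p / t))) =
      Real.cos (r * t) * (t ^ 2 * (Real.exp (-p / t) / (Real.exp t - 1))) by ring] at h

theorem ofReal_integral_exp_mul_cos {p x : ℝ} (hp : 0 < p) (hx : 0 < x) (r : ℝ) :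
    ((∫ t in Set.Ioi (0 : ℝ), Real.exp (-x * t) *
        (Real.cos (r * t) * (t ^ 2 * Real.exp (-p / t))) : ℝ) : ℂ) =
      2⁻¹ * ((∫ t in Set.Ioi (0 : ℝ), Complex.exp (-(x + Complex.I * r) * (t : ℂ)) *
          ((t ^ 2 * Real.exp (-p / t) : ℝ) : ℂ)) +
        ∫ t in Set.Ioi (0 : ℝ), Complex.exp (-(x - Complex.I * r) * (t : ℂ)) *
          ((t ^ 2 * Real.exp (-p / t) : ℝ) : ℂ)) := by
  have hint : ∀ a : ℂ, a.re = x → IntegrableOn (fun t : ℝ => Complex.exp (-a * (t : ℂ)) *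
      ((t ^ 2 * Real.exp (-p / t) : ℝ) : ℂ)) (Set.Ioi 0) := by
    intro a ha
    refine Integrable.mono (integrableOn_sq_mul_exp hx hp) (Measurable.aestronglyMeasurable (by fun_prop))
      (Filter.Eventually.of_forall fun t => le_of_eq ?_)
    rw [norm_mul, Complex.norm_exp, Complex.norm_real, Real.norm_of_nonneg (by positivity),
      Real.norm_of_nonneg (by positivity), Complex.re_mul_ofReal, Complex.neg_re, ha,
      sub_eq_add_neg, Real.exp_add, ← neg_div]
    ring
  rw [← integral_add (hint _ (by simp)) (hint _ (by simp)), ← integral_const_mul,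
    ← integral_complex_ofReal]
  refine integral_congr_ae (Filter.Eventually.of_forall fun t => ?_)
  dsimp only
  rw [show -(x + Complex.I * r) * (t : ℂ) = -x * t + -(r * t) * Complex.I by ring,
    show -(x - Complex.I * r) * (t : ℂ) = -x * t + (r * t) * Complex.I by ring,
    Complex.exp_add, Complex.exp_add]
  push_cast
  rw [Complex.cos]
  ring

theorem mathieuS_one_eq (p r : ℝ) :
    mathieuS 1 p r = ∑' m : ℕ, (-1) ^ m * r ^ (2 * m) / ((2 * m).factorial : ℝ) *
      (∫ t in Set.Ioi (0 : ℝ), t ^ (2 * m + 2) * (Real.exp (-p / t) / (Real.exp t - 1))) /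
        (2 * m + 1) := by
  rw [mathieuS, ← tsum_mul_left]
  refine tsum_congr fun n => ?_
  rw [show (2 * 1 + 2 * (n : ℝ) + 1) = ((2 * n + 2 : ℕ) : ℝ) + 1 by push_cast; ring,
    zetaP_natCast_add_one, show (1 : ℝ) + n + 1 = ((n + 1 : ℕ) : ℝ) + 1 by push_cast; ring,
    Real.Gamma_nat_eq_factorial, one_add_one_eq_two, Real.Gamma_two, Nat.factorial_succ n,
    Nat.factorial_succ (2 * n + 1), Nat.factorial_succ (2 * n)]
  have := Nat.factorial_ne_zero n
  have := Nat.factorial_ne_zero (2 * n)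
  push_cast
  field_simp
  ring

theorem mathieuS_two_eq (p : ℝ) {r : ℝ} (hr : r ≠ 0) :
    mathieuS 2 p r = 1 / (2 * r) ^ 2 * ∑' m : ℕ,
      ((-1) ^ (m + 1) * r ^ (2 * (m + 1)) / ((2 * (m + 1)).factorial : ℝ) *
        (∫ t in Set.Ioi (0 : ℝ), t ^ (2 * (m + 1) + 2) *
          (Real.exp (-p / t) / (Real.exp t - 1))) / (2 * (m + 1 : ℕ) + 1) -
      (-1) ^ (m + 1) * r ^ (2 * (m + 1)) / ((2 * (m + 1)).factorial : ℝ) *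
        (∫ t in Set.Ioi (0 : ℝ), t ^ (2 * (m + 1) + 2) *
          (Real.exp (-p / t) / (Real.exp t - 1)))) := by
  rw [mathieuS, ← tsum_mul_left, ← tsum_mul_left]
  refine tsum_congr fun n => ?_
  rw [show (2 * 2 + 2 * (n : ℝ) + 1) = ((2 * (n + 1) + 2 : ℕ) : ℝ) + 1 by push_cast; ring,
    zetaP_natCast_add_one, show (2 : ℝ) + n + 1 = ((n + 2 : ℕ) : ℝ) + 1 by push_cast; ring,
    Real.Gamma_nat_eq_factorial, show (2 : ℝ) + 1 = ((2 : ℕ) : ℝ) + 1 by norm_num,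
    Real.Gamma_nat_eq_factorial, Nat.factorial_two, Nat.factorial_succ (n + 1),
    Nat.factorial_succ n, Nat.factorial_succ (2 * (n + 1) + 1), Nat.factorial_succ (2 * (n + 1))]
  have := Nat.factorial_ne_zero n
  have := Nat.factorial_ne_zero (2 * (n + 1))
  generalize (∫ t in Set.Ioi (0 : ℝ), t ^ (2 * (n + 1) + 2) *
    (Real.exp (-p / t) / (Real.exp t - 1))) = J
  generalize (2 * (n + 1)).factorial = N at *
  push_cast
  field_simp
  ring

theorem mathieuS_two_eq_sub_integral {p r : ℝ} (hp : 0 < p) (hr0 : 0 < r) (hr1 : r < 1) :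
    mathieuS 2 p r = 1 / (2 * r) ^ 2 * (mathieuS 1 p r -
      ∫ t in Set.Ioi (0 : ℝ), Real.cos (r * t) *
        (t ^ 2 * (Real.exp (-p / t) / (Real.exp t - 1)))) := by
  have hC := hasSum_integral_pow_cos hp hr0.le hr1
  rw [mathieuS_one_eq, mathieuS_two_eq p hr0.ne', ← hC.tsum_eq]
  have hC := hC.summable
  set c : ℕ → ℝ := fun m : ℕ => (-1) ^ m * r ^ (2 * m) / ((2 * m).factorial : ℝ) *
    ∫ t in Set.Ioi (0 : ℝ), t ^ (2 * m + 2) * (Real.exp (-p / t) / (Real.exp t - 1))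
  have hS : Summable fun m : ℕ => c m / (2 * m + 1) := by
    refine Summable.of_norm_bounded hC.abs fun m => ?_
    rw [norm_div, Real.norm_eq_abs]
    refine div_le_self (abs_nonneg _) ?_
    rw [Real.norm_of_nonneg (by positivity)]
    linarith [(Nat.cast_nonneg m : (0 : ℝ) ≤ m)]
  have h := (hS.sub hC).tsum_eq_zero_add
  rw [hS.tsum_sub hC] at h
  simp only [Nat.cast_zero, mul_zero, zero_add, div_one, sub_self] at h
  rw [h]

theorem stmt5 (p r : ℝ) (hp : 0 < p) (hr0 : 0 < r) (hr1 : r < 1) :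
    (mathieuS 2 p r : ℂ) =
      (1 / (2 * r : ℂ) ^ 2) * (mathieuS 1 p r : ℂ) -
        ((p : ℂ) ^ (3/2 : ℂ) / (2 * r : ℂ) ^ 2) *
          ∑' n : ℕ,
            (besselKC 3 (2 * ((p : ℂ) * (((n : ℂ) + 1) + Complex.I * r)) ^ (1/2 : ℂ)) /
                (((n : ℂ) + 1) + Complex.I * r) ^ (3/2 : ℂ) +
              besselKC 3 (2 * ((p : ℂ) * (((n : ℂ) + 1) - Complex.I * r)) ^ (1/2 : ℂ)) /
                (((n : ℂ) + 1) - Complex.I * r) ^ (3/2 : ℂ)) := by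
  have hCr := mathieuS_two_eq_sub_integral hp hr0 hr1
  have hsum := (Complex.hasSum_ofReal.2 (hasSum_integral_exp_cos hp r)).tsum_eq
  rw [hCr]
  push_cast
  rw [← hsum, mul_sub, div_eq_mul_one_div ((p : ℂ) ^ (3 / 2 : ℂ)), mul_comm ((p : ℂ) ^ (3 / 2 : ℂ)),
    mul_assoc, ← tsum_mul_left (a := (p : ℂ) ^ (3 / 2 : ℂ))]
  congr 2
  refine tsum_congr fun n => ?_
  have hn : (0 : ℝ) < n + 1 := by positivity
  rw [ofReal_integral_exp_mul_cos hp hn, integral_cexp_neg_mul_sq hp (by simpa using hn),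
    integral_cexp_neg_mul_sq hp (by simpa using hn)]
  push_cast
  ring
end

section
/- Let p > 0 and 0 < γ < 1. Then S_{0,p}(γ) = 2 ∑_{k≥1} ∫_0^∞ e^{−kx − p/x} cos(γx) dx. -/
open Real MeasureTheory

lemma exp_neg_div_div_exp_sub_one_le {p t : ℝ} (hp : 0 < p) (ht : 0 < t) :
    exp (-p / t) / (exp t - 1) ≤ (1 + t) * exp (-t) / p := by
  have h1 : t + 1 ≤ exp t := add_one_le_exp t
  have h2 : p / t + 1 ≤ exp (p / t) := add_one_le_exp _
  have h3 : p / t ≤ exp (p / t) := by linarith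
  have h4 : p ≤ t * exp (p / t) := by
    have := mul_le_mul_of_nonneg_left h3 ht.le
    rwa [mul_div_cancel₀ _ ht.ne'] at this
  have h5 : t * exp t ≤ (1 + t) * (exp t - 1) := by nlinarith
  rw [neg_div, exp_neg, exp_neg, div_le_div_iff₀ (by linarith) hp]
  have hE := exp_pos t
  have hP := exp_pos (p / t)
  rw [← div_eq_inv_mul, ← div_eq_mul_inv, div_mul_eq_mul_div, div_le_div_iff₀ hP hE]
  calc p * exp t ≤ t * exp (p / t) * exp t := by gcongr
    _ = t * exp t * exp (p / t) := by ring
    _ ≤ _ := by gcongr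

lemma integrableOn_exp_neg_div_mul_cosh {p γ : ℝ} (hp : 0 < p) (hγ0 : 0 < γ) (hγ1 : γ < 1) :
    IntegrableOn (fun t => exp (-p / t) / (exp t - 1) * cosh (γ * t)) (Set.Ioi 0) := by
  obtain ⟨c, hc⟩ : ∃ c, c = (1 - γ) / 2 := ⟨_, rfl⟩
  have hc0 : 0 < c := by linarith
  have hdom : IntegrableOn (fun t => 1 / (p * c) * exp (-c * t)) (Set.Ioi 0) :=
    (exp_neg_integrableOn_Ioi 0 hc0).const_mul _
  refine Integrable.mono' hdom (by fun_prop) ?_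
  filter_upwards [ae_restrict_mem measurableSet_Ioi] with t ht
  have ht : 0 < t := ht
  have h1 : 0 < exp t - 1 := by linarith [add_one_le_exp t]
  have h2 := exp_neg_div_div_exp_sub_one_le hp ht
  have h3 : cosh (γ * t) ≤ exp (γ * t) := by
    rw [cosh_eq]
    have : exp (-(γ * t)) ≤ exp (γ * t) := exp_le_exp.2 (by nlinarith [mul_pos hγ0 ht])
    linarith
  have h4 : c * (1 + t) ≤ exp (c * t) := by nlinarith [add_one_le_exp (c * t)]
  rw [norm_of_nonneg (by have := cosh_pos (γ * t); positivity)]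
  calc exp (-p / t) / (exp t - 1) * cosh (γ * t)
      ≤ (1 + t) * exp (-t) / p * exp (γ * t) := by
        gcongr
    _ = c * (1 + t) * (exp (-t) * exp (γ * t)) / (p * c) := by field_simp
    _ ≤ exp (c * t) * (exp (-t) * exp (γ * t)) / (p * c) := by gcongr
    _ = 1 / (p * c) * exp (-c * t) := by
        rw [← exp_add, ← exp_add, div_eq_inv_mul, one_div]
        congr 2
        rw [hc]; ring

lemma hasSum_exp_neg_succ_mul {t : ℝ} (ht : 0 < t) :
    HasSum (fun k : ℕ => exp (-((k : ℝ) + 1) * t)) (1 / (exp t - 1)) := by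
  have h := (hasSum_geometric_of_lt_one (exp_pos (-t)).le
    (exp_lt_one_iff.mpr (neg_lt_zero.mpr ht))).mul_left (exp (-t))
  have h1 : 0 < exp t - 1 := by linarith [add_one_le_exp t]
  have hsum : exp (-t) * (1 - exp (-t))⁻¹ = 1 / (exp t - 1) := by
    have hinv : (exp t)⁻¹ < 1 := inv_lt_one_of_one_lt₀ (by linarith)
    have h2 : 1 - (exp t)⁻¹ ≠ 0 := (sub_pos.2 hinv).ne'
    have hE := exp_pos t
    rw [exp_neg, ← div_eq_mul_inv, div_eq_div_iff h2 h1.ne', mul_sub, inv_mul_cancel₀ hE.ne']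
    ring
  rw [hsum] at h
  refine h.congr_fun fun k => ?_
  rw [← exp_nat_mul, ← exp_add]
  congr 1; ring

lemma hasSum_integral_cos_power_series {p γ : ℝ} (hp : 0 < p) (hγ0 : 0 < γ) (hγ1 : γ < 1) :
    HasSum (fun n : ℕ => ∫ t in Set.Ioi (0 : ℝ), exp (-p / t) / (exp t - 1) *
        ((-1) ^ n * (γ * t) ^ (2 * n) / (2 * n).factorial))
      (∫ t in Set.Ioi (0 : ℝ), exp (-p / t) / (exp t - 1) * cos (γ * t)) := by
  have hcosh (t : ℝ) := (hasSum_cosh (γ * t)).mul_left (exp (-p / t) / (exp t - 1))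
  refine hasSum_integral_of_dominated_convergence
    (fun n t => exp (-p / t) / (exp t - 1) * ((γ * t) ^ (2 * n) / (2 * n).factorial))
    (fun n => by fun_prop) (fun n => ?_) (.of_forall fun t => (hcosh t).summable) ?_
    (.of_forall fun t => (hasSum_cos (γ * t)).mul_left _)
  · filter_upwards [ae_restrict_mem measurableSet_Ioi] with t ht
    have ht : 0 < t := ht
    have h1 : 0 < exp t - 1 := by linarith [add_one_le_exp t]
    rw [norm_mul, norm_of_nonneg (by positivity), norm_div, norm_mul, norm_pow, norm_neg, norm_one,
      one_pow, one_mul, norm_of_nonneg (by positivity), norm_of_nonneg (by positivity)]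
  · simp_rw [fun t => (hcosh t).tsum_eq]
    exact integrableOn_exp_neg_div_mul_cosh hp hγ0 hγ1

lemma hasSum_integral_exp_mul_cos {p γ : ℝ} (hp : 0 < p) (hγ0 : 0 < γ) (hγ1 : γ < 1) :
    HasSum (fun k : ℕ => ∫ x in Set.Ioi (0 : ℝ), exp (-((k : ℝ) + 1) * x - p / x) * cos (γ * x))
      (∫ t in Set.Ioi (0 : ℝ), exp (-p / t) / (exp t - 1) * cos (γ * t)) := by
  have hexp {t : ℝ} (ht : 0 < t) (b : ℝ) :
      HasSum (fun k : ℕ => exp (-((k : ℝ) + 1) * t - p / t) * b)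
        (exp (-p / t) / (exp t - 1) * b) := by
    have h := ((hasSum_exp_neg_succ_mul ht).mul_left (exp (-p / t))).mul_right b
    rw [mul_one_div] at h
    refine h.congr_fun fun k => ?_
    rw [← exp_add]
    congr 2; ring
  have hpos : ∀ᵐ t ∂volume.restrict (Set.Ioi (0 : ℝ)), 0 < t :=
    ae_restrict_mem measurableSet_Ioi
  refine hasSum_integral_of_dominated_convergence
    (fun k t => exp (-((k : ℝ) + 1) * t - p / t) * cosh (γ * t))
    (fun n => by fun_prop) (fun n => .of_forall fun t => ?_)
    (hpos.mono fun t ht => (hexp ht _).summable) ?_ (hpos.mono fun t ht => hexp ht _)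
  · rw [norm_mul, norm_of_nonneg (exp_pos _).le]
    gcongr
    exact (abs_cos_le_one _).trans (one_le_cosh _)
  · exact (integrableOn_exp_neg_div_mul_cosh hp hγ0 hγ1).congr
      (hpos.mono fun t ht => (hexp ht _).tsum_eq.symm)

theorem stmt6 (p γ : ℝ) (hp : 0 < p) (hγ0 : 0 < γ) (hγ1 : γ < 1) :
    mathieuS 0 p γ =
      2 * ∑' k : ℕ,
        ∫ x in Set.Ioi (0:ℝ), Real.exp (-((k : ℝ) + 1) * x - p / x) * Real.cos (γ * x) := by
  rw [(hasSum_integral_exp_mul_cos hp hγ0 hγ1).tsum_eq,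
    ← (hasSum_integral_cos_power_series hp hγ0 hγ1).tsum_eq, mathieuS]
  congr 2
  ext n
  have hfac : (n.factorial : ℝ) ≠ 0 := by positivity
  have hexponent : (2 * 0 + 2 * n + 1 : ℝ) = ((2 * n : ℕ) : ℝ) + 1 := by push_cast; ring
  rw [zetaP, hexponent, zero_add, zero_add, Gamma_nat_eq_factorial, Gamma_nat_eq_factorial,
    Gamma_one, mul_one, div_self hfac, mul_one, add_sub_cancel_right, ← mul_assoc,
    mul_right_comm, ← integral_const_mul]
  congr 1
  ext t
  rw [rpow_natCast, mul_pow]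
  ring
end
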